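/- Let d be an even positive integer, let u be a continuous irreducible unitary representation of SU(2) on ℂ^d, and let r₀ be a d×d unitary matrix with r₀² = I and r₀ u(g) r₀* = conj(u(g)) for all g in SU(2). Then conj(r₀) = -r₀; that is, r₀ has purely imaginary entries. -/

import Mathlib

open Matrix

/-- The special unitary group `SU(2)`: `2 × 2` complex matrices that are
unitary and have determinant `1`. -/
def SU2 : Set (Matrix (Fin 2) (Fin 2) ℂ) :=
  {g | g ∈ Matrix.unitaryGroup (Fin 2) ℂ ∧ g.det = 1}

/-- The diagonal one-parameter subgroup of `SU(2)`. -/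
noncomputable def torus (θ : ℝ) : Matrix (Fin 2) (Fin 2) ℂ :=
  !![Complex.exp (θ * Complex.I), 0; 0, Complex.exp (-(θ * Complex.I))]

/-- The one-parameter subgroup of real rotations in `SU(2)`. -/
noncomputable def rot (θ : ℝ) : Matrix (Fin 2) (Fin 2) ℂ :=
  !![(Real.cos θ : ℂ), -(Real.sin θ : ℂ); (Real.sin θ : ℂ), (Real.cos θ : ℂ)]

lemma conj_exp_ofReal_mul_I (θ : ℝ) :
    (starRingEnd ℂ) (Complex.exp (θ * Complex.I)) = Complex.exp (-(θ * Complex.I)) := by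
  rw [← Complex.exp_conj]; simp

lemma mem_SU2_iff (g : Matrix (Fin 2) (Fin 2) ℂ) :
    g ∈ SU2 ↔ ∃ a b : ℂ, ‖a‖ ^ 2 + ‖b‖ ^ 2 = 1 ∧
      g = !![a, -(starRingEnd ℂ) b; b, (starRingEnd ℂ) a] := by
  constructor
  · rintro ⟨hg, hdet⟩
    have hinv : star g = g.adjugate := by
      have h1 : star g * g = 1 := hg.1
      have h2 : g * g.adjugate = 1 := by rw [Matrix.mul_adjugate, hdet, one_smul]
      exact left_inv_eq_right_inv h1 h2
    rw [Matrix.adjugate_fin_two] at hinv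
    have h00 := congrFun (congrFun hinv 0) 0
    have h01 := congrFun (congrFun hinv 0) 1
    simp only [Matrix.star_apply, Matrix.of_apply, Matrix.cons_val', Matrix.cons_val_zero,
      Matrix.cons_val_one, Matrix.cons_val_fin_one] at h00 h01
    have h01' : g 0 1 = -(starRingEnd ℂ) (g 1 0) := by
      rw [eq_neg_iff_add_eq_zero, add_comm, ← eq_neg_iff_add_eq_zero]; exact h01
    have h00' : g 1 1 = (starRingEnd ℂ) (g 0 0) := h00.symm
    refine ⟨g 0 0, g 1 0, ?_, ?_⟩
    · rw [Matrix.det_fin_two, h01', h00'] at hdet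
      have : ((‖g 0 0‖ ^ 2 + ‖g 1 0‖ ^ 2 : ℝ) : ℂ) = 1 := by
        push_cast
        rw [← Complex.mul_conj', ← Complex.mul_conj', ← hdet]; ring
      exact_mod_cast this
    · rw [← h01', ← h00']; exact Matrix.eta_fin_two g
  · rintro ⟨a, b, hab, rfl⟩
    have key : a * (starRingEnd ℂ) a + b * (starRingEnd ℂ) b = 1 := by
      rw [Complex.mul_conj', Complex.mul_conj']; exact_mod_cast hab
    refine ⟨?_, ?_⟩
    · rw [Matrix.mem_unitaryGroup_iff]
      ext i j
      fin_cases i <;> fin_cases j <;>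
        simp [Matrix.mul_apply, Fin.sum_univ_two] <;>
        first | linear_combination key | ring
    · rw [Matrix.det_fin_two_of]; linear_combination key

lemma torus_mem (θ : ℝ) : torus θ ∈ SU2 := by
  rw [mem_SU2_iff]
  refine ⟨Complex.exp (θ * Complex.I), 0, by simp [Complex.norm_exp_ofReal_mul_I], ?_⟩
  rw [conj_exp_ofReal_mul_I]; simp [torus]

lemma rot_mem (θ : ℝ) : rot θ ∈ SU2 := by
  rw [mem_SU2_iff]
  refine ⟨(Real.cos θ : ℂ), (Real.sin θ : ℂ), ?_, ?_⟩
  · simp only [Complex.norm_real, Real.norm_eq_abs, sq_abs]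
    exact Real.cos_sq_add_sin_sq θ
  · simp only [Complex.conj_ofReal]; rfl

lemma mul_mem_SU2 {g h : Matrix (Fin 2) (Fin 2) ℂ} (hg : g ∈ SU2) (hh : h ∈ SU2) :
    g * h ∈ SU2 :=
  ⟨mul_mem hg.1 hh.1, by rw [Matrix.det_mul, hg.2, hh.2, one_mul]⟩

lemma transpose_mem_SU2 {g : Matrix (Fin 2) (Fin 2) ℂ} (hg : g ∈ SU2) : gᵀ ∈ SU2 := by
  rw [mem_SU2_iff] at hg ⊢
  obtain ⟨a, b, hab, rfl⟩ := hg
  refine ⟨a, -(starRingEnd ℂ) b, by simpa using hab, ?_⟩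
  ext i j
  fin_cases i <;> fin_cases j <;> simp

lemma torus_zero : torus 0 = 1 := by
  ext i j
  fin_cases i <;> fin_cases j <;> simp [torus]

lemma rot_zero : rot 0 = 1 := by
  ext i j
  fin_cases i <;> fin_cases j <;> simp [rot]

lemma torus_add (s t : ℝ) : torus (s + t) = torus s * torus t := by
  ext i j
  fin_cases i <;> fin_cases j <;>
    simp [torus, ← Complex.exp_add] <;> ring_nf

lemma rot_add (s t : ℝ) : rot (s + t) = rot s * rot t := by
  ext i j
  fin_cases i <;> fin_cases j <;>
    simp [rot, Complex.cos_add, Complex.sin_add] <;> ring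

lemma continuous_torus : Continuous torus := by
  unfold torus
  refine continuous_matrix fun i j => ?_
  fin_cases i <;> fin_cases j <;> simp <;> fun_prop

lemma continuous_rot : Continuous rot := by
  unfold rot
  refine continuous_matrix fun i j => ?_
  fin_cases i <;> fin_cases j <;> simp <;> fun_prop

lemma torus_two_pi : torus (2 * Real.pi) = 1 := by
  ext i j
  fin_cases i <;> fin_cases j <;> simp [torus, Complex.exp_neg]

lemma torus_pi : torus Real.pi = -1 := by
  ext i j
  fin_cases i <;> fin_cases j <;> simp [torus, Complex.exp_neg]

lemma rot_pi_div_two_sq : rot (Real.pi / 2) * rot (Real.pi / 2) = -1 := by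
  rw [← rot_add, add_halves]
  ext i j
  fin_cases i <;> fin_cases j <;> simp [rot]

lemma rot_pi_div_two_mul_torus (θ : ℝ) :
    rot (Real.pi / 2) * torus θ = torus (-θ) * rot (Real.pi / 2) := by
  ext i j
  fin_cases i <;> fin_cases j <;> simp [rot, torus]

lemma torus_transpose (θ : ℝ) : (torus θ)ᵀ = torus θ := by
  ext i j
  fin_cases i <;> fin_cases j <;> simp [torus]

lemma rot_transpose (θ : ℝ) :
    (rot θ)ᵀ = torus (Real.pi / 2) * rot θ * torus (-(Real.pi / 2)) := by
  ext i j
  fin_cases i <;> fin_cases j <;>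
    simp [rot, torus, Complex.exp_neg, Complex.exp_pi_div_two_mul_I] <;>
    ring_nf <;> simp

/-- Euler decomposition of a matrix in `SU(2)`, given by the polar forms of its entries. -/
lemma torus_mul_rot_mul_torus (p q θ : ℝ) :
    torus ((p - q) / 2) * rot θ * torus ((p + q) / 2) =
      !![Real.cos θ * Complex.exp (p * Complex.I),
          -(Real.sin θ * Complex.exp (-(q * Complex.I)));
        Real.sin θ * Complex.exp (q * Complex.I),
          Real.cos θ * Complex.exp (-(p * Complex.I))] := by
  have e1 : Complex.exp (p * Complex.I) = Complex.exp (((p - q) / 2 : ℝ) * Complex.I) *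
      Complex.exp (((p + q) / 2 : ℝ) * Complex.I) := by
    rw [← Complex.exp_add]; congr 1; push_cast; ring
  have e2 : Complex.exp (-(q * Complex.I)) = Complex.exp (((p - q) / 2 : ℝ) * Complex.I) *
      Complex.exp (-(((p + q) / 2 : ℝ) * Complex.I)) := by
    rw [← Complex.exp_add]; congr 1; push_cast; ring
  have e3 : Complex.exp (q * Complex.I) = Complex.exp (-(((p - q) / 2 : ℝ) * Complex.I)) *
      Complex.exp (((p + q) / 2 : ℝ) * Complex.I) := by
    rw [← Complex.exp_add]; congr 1; push_cast; ring
  have e4 : Complex.exp (-(p * Complex.I)) = Complex.exp (-(((p - q) / 2 : ℝ) * Complex.I)) *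
      Complex.exp (-(((p + q) / 2 : ℝ) * Complex.I)) := by
    rw [← Complex.exp_add]; congr 1; push_cast; ring
  rw [e1, e2, e3, e4, torus, rot, torus]
  simp only [Matrix.mul_fin_two]
  congr! 3 <;> ring_nf

lemma eq_torus_mul_rot_mul_torus {a b : ℂ} {θ q : ℝ} (ha : ‖a‖ = Real.cos θ)
    (hq : b = Real.sin θ * Complex.exp (q * Complex.I)) :
    !![a, -(starRingEnd ℂ) b; b, (starRingEnd ℂ) a] =
      torus ((a.arg - q) / 2) * rot θ * torus ((a.arg + q) / 2) := by
  have ha' : a = Real.cos θ * Complex.exp (a.arg * Complex.I) := by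
    rw [← ha, Complex.norm_mul_exp_arg_mul_I]
  have hac : (starRingEnd ℂ) a = Real.cos θ * Complex.exp (-(a.arg * Complex.I)) := by
    conv_lhs => rw [ha']
    rw [map_mul, Complex.conj_ofReal, conj_exp_ofReal_mul_I]
  have hbc : (starRingEnd ℂ) b = Real.sin θ * Complex.exp (-(q * Complex.I)) := by
    conv_lhs => rw [hq]
    rw [map_mul, Complex.conj_ofReal, conj_exp_ofReal_mul_I]
  rw [torus_mul_rot_mul_torus, ← ha', ← hac, ← hbc, ← hq]

lemma exists_euler {g : Matrix (Fin 2) (Fin 2) ℂ} (hg : g ∈ SU2) :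
    ∃ α θ β : ℝ, g = torus α * rot θ * torus β := by
  obtain ⟨a, b, hab, rfl⟩ := (mem_SU2_iff g).1 hg
  have hb1 : ‖b‖ ≤ 1 := by nlinarith [norm_nonneg b, sq_nonneg ‖a‖]
  have hsin : Real.sin (Real.arcsin ‖b‖) = ‖b‖ :=
    Real.sin_arcsin (by linarith [norm_nonneg b]) hb1
  refine ⟨_, _, _, eq_torus_mul_rot_mul_torus (θ := Real.arcsin ‖b‖) (q := b.arg) ?_ ?_⟩
  · rw [Real.cos_arcsin, ← hab, add_sub_cancel_right, Real.sqrt_sq (norm_nonneg a)]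
  · rw [hsin, Complex.norm_mul_exp_arg_mul_I]

/-- The upper left entry of a product of two conjugates of the rotation by `θ`. -/
noncomputable def rotProdEntry (φ θ : ℝ) : ℂ :=
  (Real.cos θ : ℂ) ^ 2 - (Real.sin θ : ℂ) ^ 2 * Complex.exp ((4 * φ : ℝ) * Complex.I)

/-- The Euler decomposition of a product of two conjugates of the rotation by `θ`. -/
lemma torus_rot_torus_rot_torus (φ θ : ℝ) :
    torus φ * rot θ * torus (-2 * φ) * rot θ * torus φ =
      torus ((rotProdEntry φ θ).arg / 2) *
        rot (Real.arcsin (Real.sin (2 * θ) * Real.cos (2 * φ))) *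
        torus ((rotProdEntry φ θ).arg / 2) := by
  set b : ℝ := Real.sin (2 * θ) * Real.cos (2 * φ) with hb
  have hb1 : b ^ 2 ≤ 1 := by
    have h1 := Real.sin_sq_le_one (2 * θ)
    have h2 := Real.cos_sq_le_one (2 * φ)
    rw [hb, mul_pow]
    nlinarith [sq_nonneg (Real.sin (2 * θ)), sq_nonneg (Real.cos (2 * φ))]
  have hsin : Real.sin (Real.arcsin b) = b := Real.sin_arcsin (by nlinarith) (by nlinarith)
  have hE : Complex.exp ((4 * φ : ℝ) * Complex.I) = (Complex.exp (φ * Complex.I)) ^ 4 := by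
    rw [← Complex.exp_nat_mul]; congr 1; push_cast; ring
  have hneg : Complex.exp ((-2 * φ : ℝ) * Complex.I) = (Complex.exp (-(φ * Complex.I))) ^ 2 := by
    rw [← Complex.exp_nat_mul]; congr 1; push_cast; ring
  have hpos : Complex.exp (-((-2 * φ : ℝ) * Complex.I)) = (Complex.exp (φ * Complex.I)) ^ 2 := by
    rw [← Complex.exp_nat_mul]; congr 1; push_cast; ring
  have hzw : Complex.exp (φ * Complex.I) * Complex.exp (-(φ * Complex.I)) = 1 := by
    rw [← Complex.exp_add]; simp
  have hcos : (Real.cos (2 * φ) : ℂ) =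
      ((Complex.exp (φ * Complex.I)) ^ 2 + (Complex.exp (-(φ * Complex.I))) ^ 2) / 2 := by
    rw [Complex.ofReal_cos, Complex.cos, ← Complex.exp_nat_mul, ← Complex.exp_nat_mul]
    congr 3 <;> · push_cast; ring_nf
  have hsin2 : (Real.sin (2 * θ) : ℂ) = 2 * Real.sin θ * Real.cos θ := by
    rw [Real.sin_two_mul]; push_cast; ring
  have hconj : (starRingEnd ℂ) (rotProdEntry φ θ) =
      (Real.cos θ : ℂ) ^ 2 - (Real.sin θ : ℂ) ^ 2 * (Complex.exp (-(φ * Complex.I))) ^ 4 := by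
    rw [rotProdEntry, hE]
    simp only [map_sub, map_mul, map_pow, Complex.conj_ofReal, conj_exp_ofReal_mul_I]
  have hmat : torus φ * rot θ * torus (-2 * φ) * rot θ * torus φ =
      !![rotProdEntry φ θ, -(starRingEnd ℂ) (b : ℂ); (b : ℂ),
        (starRingEnd ℂ) (rotProdEntry φ θ)] := by
    rw [hconj, Complex.conj_ofReal, hb, Complex.ofReal_mul, hcos, hsin2, rotProdEntry, hE,
      torus, torus, rot, hneg, hpos]
    generalize Complex.exp (φ * Complex.I) = z at hzw ⊢
    generalize Complex.exp (-(φ * Complex.I)) = w at hzw ⊢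
    generalize (Real.cos θ : ℂ) = c
    generalize (Real.sin θ : ℂ) = s
    simp only [Matrix.mul_fin_two]
    congr! 3
    · linear_combination c ^ 2 * (z * w + 1) * hzw
    · congr! 1
      · linear_combination -(c * s * (z ^ 2 + w ^ 2)) * hzw
    · congr! 1
      · linear_combination c * s * (z ^ 2 + w ^ 2) * hzw
      · congr! 1
        linear_combination c ^ 2 * (z * w + 1) * hzw
  have hmem : torus φ * rot θ * torus (-2 * φ) * rot θ * torus φ ∈ SU2 :=
    mul_mem_SU2 (mul_mem_SU2 (mul_mem_SU2 (mul_mem_SU2 (torus_mem _) (rot_mem _)) (torus_mem _))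
      (rot_mem _)) (torus_mem _)
  have hnorm : ‖rotProdEntry φ θ‖ ^ 2 = 1 - b ^ 2 := by
    have hdet := hmem.2
    rw [hmat, Matrix.det_fin_two_of, Complex.mul_conj', Complex.conj_ofReal] at hdet
    have : ((‖rotProdEntry φ θ‖ ^ 2 : ℝ) : ℂ) = ((1 - b ^ 2 : ℝ) : ℂ) := by
      push_cast; linear_combination hdet
    exact_mod_cast this
  rw [hmat, eq_torus_mul_rot_mul_torus (θ := Real.arcsin b) (q := 0), sub_zero, add_zero]
  · rw [Real.cos_arcsin, ← hnorm, Real.sqrt_sq (norm_nonneg _)]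
  · rw [hsin]; simp

/-- A continuous one-parameter subgroup of a Banach algebra is generated by an element. -/
lemma exists_eq_exp_smul {𝔸 : Type*} [NormedRing 𝔸] [NormedAlgebra ℝ 𝔸] [CompleteSpace 𝔸]
    {T : ℝ → 𝔸} (hT : Continuous T) (hT0 : T 0 = 1) (hadd : ∀ s t, T (s + t) = T s * T t) :
    ∃ A : 𝔸, ∀ t, T t = NormedSpace.exp (t • A) := by
  let +nondep : NormedAlgebra ℚ 𝔸 := .restrictScalars ℚ ℝ 𝔸
  have hintegral : ∀ a b, IntervalIntegrable T MeasureTheory.volume a b :=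
    fun a b => hT.intervalIntegrable a b
  set F : ℝ → 𝔸 := fun a => ∫ x in (0 : ℝ)..a, T x with hF
  have hFd : ∀ a, HasDerivAt F (T a) a := fun a =>
    intervalIntegral.integral_hasDerivAt_right (hintegral 0 a)
      (hT.stronglyMeasurableAtFilter _ _) hT.continuousAt
  have hunit : ∃ a, a ≠ 0 ∧ IsUnit (a⁻¹ • F a) := by
    have hslope : Filter.Tendsto (fun a : ℝ => a⁻¹ • F a) (nhdsWithin 0 {0}ᶜ) (nhds 1) := by
      have := (hFd 0).tendsto_slope
      rw [hT0] at this
      refine this.congr fun a => ?_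
      simp [slope, hF]
    have h1 := hslope.eventually (Units.isOpen.mem_nhds isUnit_one)
    obtain ⟨a, ha, ha'⟩ := (h1.and self_mem_nhdsWithin).exists
    exact ⟨a, ha', ha⟩
  obtain ⟨a, ha, hu⟩ := hunit
  have hu' : IsUnit (F a) := by
    have : F a = (algebraMap ℝ 𝔸 a) * (a⁻¹ • F a) := by
      rw [← Algebra.smul_def, smul_smul, mul_inv_cancel₀ ha, one_smul]
    rw [this]
    exact ((isUnit_iff_ne_zero.2 ha).map (algebraMap ℝ 𝔸)).mul hu
  obtain ⟨v, hv⟩ := hu'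
  have hTF : ∀ t, T t = (F (t + a) - F t) * (↑v⁻¹ : 𝔸) := by
    intro t
    rw [Units.eq_mul_inv_iff_mul_eq, hv]
    have h1 : T t * F a = ∫ x in (0 : ℝ)..a, T (t + x) := by
      simp only [hadd]
      rw [hF]
      exact ((ContinuousLinearMap.mul ℝ 𝔸 (T t)).intervalIntegral_comp_comm (hintegral 0 a)).symm
    rw [h1, intervalIntegral.integral_comp_add_left (fun x => T x), add_zero]
    rw [intervalIntegral.integral_interval_sub_left (hintegral _ _) (hintegral _ _)]
  have hTd : ∃ A, HasDerivAt T A 0 := by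
    have h1 : HasDerivAt (fun t => (F (t + a) - F t) * (↑v⁻¹ : 𝔸)) _ 0 :=
      (((hFd (0 + a)).comp_add_const 0 a).sub (hFd 0)).mul_const _
    rw [← funext hTF] at h1
    exact ⟨_, h1⟩
  obtain ⟨A, hA⟩ := hTd
  have hTd' : ∀ t, HasDerivAt T (T t * A) t := by
    intro t
    have h1 : HasDerivAt (fun s => T t * T (s - t)) (T t * A) t := by
      refine HasDerivAt.const_mul (T t) ?_
      have : HasDerivAt T A (t - t) := by rwa [sub_self]
      exact this.comp_sub_const t t
    refine h1.congr_of_eventuallyEq (Filter.Eventually.of_forall fun s => ?_)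
    simp only [← hadd]; congr 1; ring
  have hE : ∀ t, HasDerivAt (fun s : ℝ => NormedSpace.exp (s • (-A)))
      ((-A) * NormedSpace.exp (t • (-A))) t := fun t => hasDerivAt_exp_smul_const' (-A) t
  have hprod : ∀ t, HasDerivAt (fun s => T s * NormedSpace.exp (s • (-A))) 0 t := by
    intro t
    refine ((hTd' t).fun_mul (hE t)).congr_deriv ?_
    rw [← mul_assoc, mul_neg, neg_mul, add_neg_cancel]
  have hconst : ∀ t, T t * NormedSpace.exp (t • (-A)) = 1 := by
    intro t
    have := is_const_of_deriv_eq_zero (fun t => (hprod t).differentiableAt)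
      (fun t => (hprod t).deriv) t 0
    simpa [hT0] using this
  refine ⟨A, fun t => ?_⟩
  have hinv : NormedSpace.exp (t • (-A)) * NormedSpace.exp (t • A) = 1 := by
    rw [smul_neg, ← NormedSpace.exp_add_of_commute ((Commute.refl (t • A)).neg_left),
      neg_add_cancel, NormedSpace.exp_zero]
  calc T t = T t * (NormedSpace.exp (t • (-A)) * NormedSpace.exp (t • A)) := by
        rw [hinv, mul_one]
    _ = NormedSpace.exp (t • A) := by rw [← mul_assoc, hconst, one_mul]

/-- Schur's lemma for an irreducible set of complex matrices. -/
lemma eq_smul_one_of_commute {n : Type*} [Fintype n] [DecidableEq n] {S : Set (Matrix n n ℂ)}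
    (hS : ∀ W : Submodule ℂ (n → ℂ), (∀ M ∈ S, ∀ x ∈ W, M.mulVec x ∈ W) → W = ⊥ ∨ W = ⊤)
    {A : Matrix n n ℂ} (hA : ∀ M ∈ S, M * A = A * M) : ∃ c : ℂ, A = c • 1 := by
  rcases isEmpty_or_nonempty n with hn | hn
  · exact ⟨0, Subsingleton.elim _ _⟩
  obtain ⟨c, hc⟩ := Module.End.exists_eigenvalue (Matrix.toLin' A)
  refine ⟨c, ?_⟩
  have htop := (hS (Module.End.eigenspace (Matrix.toLin' A) c) fun M hM x hx => by
    rw [Module.End.mem_eigenspace_iff, Matrix.toLin'_apply] at hx ⊢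
    rw [Matrix.mulVec_mulVec, ← hA M hM, ← Matrix.mulVec_mulVec, hx,
      Matrix.mulVec_smul]).resolve_left hc
  refine Matrix.ext_of_mulVec_single fun i => ?_
  have hi : Pi.single i 1 ∈ Module.End.eigenspace (Matrix.toLin' A) c := htop ▸ Submodule.mem_top
  rw [Module.End.mem_eigenspace_iff, Matrix.toLin'_apply] at hi
  rw [hi, Matrix.smul_mulVec, Matrix.one_mulVec]

/-- The continuous irreducible matrix representations of `SU(2)`. -/
structure IsIrrep {n : Type*} [Fintype n] [DecidableEq n]
    (u : Matrix (Fin 2) (Fin 2) ℂ → Matrix n n ℂ) : Prop where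
  cont : ContinuousOn u SU2
  one : u 1 = 1
  mul : ∀ g ∈ SU2, ∀ h ∈ SU2, u (g * h) = u g * u h
  irred : ∀ W : Submodule ℂ (n → ℂ),
    (∀ g ∈ SU2, ∀ x ∈ W, (u g).mulVec x ∈ W) → W = ⊥ ∨ W = ⊤

/-- The standard basis consists of weight vectors with weights `lam`. -/
def HasWeights {n : Type*} [DecidableEq n]
    (u : Matrix (Fin 2) (Fin 2) ℂ → Matrix n n ℂ) (lam : n → ℤ) : Prop :=
  ∀ θ : ℝ, u (torus θ) = Matrix.diagonal fun j => Complex.exp (lam j * θ * Complex.I)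

lemma sum_filter_eq_zero_of_sum_mul_exp_eq_zero {n : Type*} [Fintype n] (lam : n → ℤ)
    (c : n → ℂ) (h : ∀ θ : ℝ, ∑ j, c j * Complex.exp (lam j * θ * Complex.I) = 0) (k : ℤ) :
    ∑ j with lam j = k, c j = 0 := by
  have horth : ∀ m : ℤ, (∫ θ in (0 : ℝ)..(2 * Real.pi), Complex.exp (m * Complex.I * θ)) =
      if m = 0 then (2 * Real.pi : ℂ) else 0 := by
    intro m
    split_ifs with hm
    · simp [hm]
    · have hm' : (m : ℂ) * Complex.I ≠ 0 := by simp [hm]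
      rw [integral_exp_mul_complex hm']
      have : (m : ℂ) * Complex.I * ((2 * Real.pi : ℝ) : ℂ) = m * (2 * Real.pi * Complex.I) := by
        push_cast; ring
      rw [this, Complex.exp_int_mul_two_pi_mul_I]
      simp
  have hintegral : (∫ θ in (0 : ℝ)..(2 * Real.pi),
      ∑ j, c j * Complex.exp ((lam j - k : ℤ) * Complex.I * θ)) = 0 := by
    have : ∀ θ : ℝ, ∑ j, c j * Complex.exp ((lam j - k : ℤ) * Complex.I * θ) = 0 := by
      intro θ
      have h1 : ∀ j, c j * Complex.exp ((lam j - k : ℤ) * Complex.I * θ) =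
          c j * Complex.exp (lam j * θ * Complex.I) * Complex.exp (-(k * θ * Complex.I)) := by
        intro j
        rw [mul_assoc (c j), ← Complex.exp_add]
        congr 2
        push_cast
        ring
      rw [Finset.sum_congr rfl fun j _ => h1 j, ← Finset.sum_mul, h θ, zero_mul]
    simp only [this, intervalIntegral.integral_zero]
  rw [intervalIntegral.integral_finsetSum
    (fun j _ => (Continuous.intervalIntegrable (by fun_prop) _ _))] at hintegral
  simp only [intervalIntegral.integral_const_mul, horth, sub_eq_zero, mul_ite, mul_zero] at hintegral
  rw [← Finset.sum_filter, ← Finset.sum_mul] at hintegral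
  exact (mul_eq_zero.1 hintegral).resolve_right (by simp [Real.pi_ne_zero])

lemma int_eq_of_exp_eq {p q : ℤ}
    (h : ∀ θ : ℝ, Complex.exp (p * θ * Complex.I) = Complex.exp (q * θ * Complex.I)) : p = q := by
  by_contra hpq
  have := sum_filter_eq_zero_of_sum_mul_exp_eq_zero ![p, q] ![1, -1]
    (fun θ => by simp [Fin.sum_univ_two, h θ]) p
  rw [Finset.sum_filter, Fin.sum_univ_two] at this
  simp [Ne.symm hpq] at this

section Weights

variable {n : Type*} [Fintype n] [DecidableEq n]
  {u : Matrix (Fin 2) (Fin 2) ℂ → Matrix n n ℂ} {lam : n → ℤ}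

lemma IsIrrep.eq_smul_one (hu : IsIrrep u) {A : Matrix n n ℂ}
    (hA : ∀ g ∈ SU2, u g * A = A * u g) : ∃ c : ℂ, A = c • 1 := by
  refine eq_smul_one_of_commute (S := u '' SU2) (fun W hW => hu.irred W fun g hg => ?_) ?_
  · exact hW _ ⟨g, hg, rfl⟩
  · rintro _ ⟨g, hg, rfl⟩
    exact hA g hg

lemma IsIrrep.torus_rot_torus_apply (hu : IsIrrep u) (hw : HasWeights u lam) (α θ β : ℝ)
    (a b : n) : u (torus α * rot θ * torus β) a b =
      Complex.exp (lam a * α * Complex.I) * u (rot θ) a b *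
        Complex.exp (lam b * β * Complex.I) := by
  rw [hu.mul _ (mul_mem_SU2 (torus_mem _) (rot_mem _)) _ (torus_mem _),
    hu.mul _ (torus_mem _) _ (rot_mem _), hw, hw, Matrix.mul_diagonal, Matrix.diagonal_mul]

lemma IsIrrep.transpose_apply (hu : IsIrrep u) (hw : HasWeights u lam)
    {g : Matrix (Fin 2) (Fin 2) ℂ} (hg : g ∈ SU2) {a b : n} (hab : lam a = lam b) :
    u gᵀ a b = u g a b := by
  obtain ⟨α, θ, β, rfl⟩ := exists_euler hg
  have ht : (torus α * rot θ * torus β)ᵀ =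
      torus (β + Real.pi / 2) * rot θ * torus (-(Real.pi / 2) + α) := by
    rw [Matrix.transpose_mul, Matrix.transpose_mul, torus_transpose, torus_transpose,
      rot_transpose, torus_add, torus_add]
    simp only [mul_assoc]
  rw [ht, hu.torus_rot_torus_apply hw, hu.torus_rot_torus_apply hw, hab,
    mul_right_comm (Complex.exp _), ← Complex.exp_add,
    mul_right_comm (Complex.exp _), ← Complex.exp_add]
  congr 2
  push_cast
  ring

lemma IsIrrep.weight_block_commute (hu : IsIrrep u) (hw : HasWeights u lam) (k : ℤ)
    {g h : Matrix (Fin 2) (Fin 2) ℂ} (hg : g ∈ SU2) (hh : h ∈ SU2) {a b : n}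
    (ha : lam a = k) (hb : lam b = k) :
    ∑ j with lam j = k, u g a j * u h j b = ∑ j with lam j = k, u h a j * u g j b := by
  have hmul : ∀ g' ∈ SU2, ∀ h' ∈ SU2, ∀ θ : ℝ, u (g' * torus θ * h') a b =
      ∑ j, u g' a j * u h' j b * Complex.exp (lam j * θ * Complex.I) := by
    intro g' hg' h' hh' θ
    rw [hu.mul _ (mul_mem_SU2 hg' (torus_mem _)) _ hh', hu.mul _ hg' _ (torus_mem _), hw,
      Matrix.mul_apply]
    refine Finset.sum_congr rfl fun j _ => ?_
    rw [Matrix.mul_diagonal]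
    ring
  have hz := sum_filter_eq_zero_of_sum_mul_exp_eq_zero lam
    (fun j => u g a j * u h j b - u hᵀ a j * u gᵀ j b) (fun θ => by
      simp only [sub_mul, Finset.sum_sub_distrib]
      rw [← hmul g hg h hh, ← hmul _ (transpose_mem_SU2 hh) _ (transpose_mem_SU2 hg),
        ← hu.transpose_apply hw (mul_mem_SU2 (mul_mem_SU2 hg (torus_mem θ)) hh) (ha.trans hb.symm),
        Matrix.transpose_mul, Matrix.transpose_mul, torus_transpose, ← mul_assoc, sub_self]) k
  rw [Finset.sum_sub_distrib, sub_eq_zero] at hz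
  rw [hz]
  refine Finset.sum_congr rfl fun j hj => ?_
  have hj' : lam j = k := (Finset.mem_filter.1 hj).2
  rw [hu.transpose_apply hw hh (ha.trans hj'.symm), hu.transpose_apply hw hg (hj'.trans hb.symm)]

lemma IsIrrep.weight_block_irred (hu : IsIrrep u) (k : ℤ)
    (W : Submodule ℂ ({j // lam j = k} → ℂ))
    (hW : ∀ g ∈ SU2, ∀ x ∈ W, ((u g).submatrix Subtype.val Subtype.val).mulVec x ∈ W) :
    W = ⊥ ∨ W = ⊤ := by
  set π : (n → ℂ) →ₗ[ℂ] ({j // lam j = k} → ℂ) := LinearMap.funLeft ℂ ℂ Subtype.val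
  set ι : ({j // lam j = k} → ℂ) → n → ℂ :=
    fun x j => if h : lam j = k then x ⟨j, h⟩ else 0
  have hπι : ∀ x, π (ι x) = x := by
    intro x
    ext ⟨j, hj⟩
    simp [π, ι, LinearMap.funLeft_apply, hj]
  have hπu : ∀ g x, π ((u g).mulVec (ι x)) =
      ((u g).submatrix Subtype.val Subtype.val).mulVec x := by
    intro g x
    ext a
    simp only [π, LinearMap.funLeft_apply, Matrix.mulVec, dotProduct, Matrix.submatrix_apply]
    rw [← Finset.sum_subset (Finset.filter_subset (fun j => lam j = k) Finset.univ),
      Finset.sum_subtype (p := fun j => lam j = k) _ (by simp)]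
    · refine Finset.sum_congr rfl fun j _ => ?_
      simp [ι, j.2]
    · intro j _ hj
      have : lam j ≠ k := by simpa using hj
      simp [ι, this]
  set W' : Submodule ℂ (n → ℂ) :=
    Submodule.span ℂ {y | ∃ g ∈ SU2, ∃ x ∈ W, (u g).mulVec (ι x) = y} with hW'
  have hmem : ∀ x ∈ W, ι x ∈ W' := fun x hx =>
    Submodule.subset_span ⟨1, by rw [← torus_zero]; exact torus_mem 0, x, hx,
      by rw [hu.one, Matrix.one_mulVec]⟩
  have hle : W' ≤ W.comap π := by
    rw [hW', Submodule.span_le]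
    rintro _ ⟨g, hg, x, hx, rfl⟩
    simp only [SetLike.mem_coe, Submodule.mem_comap, hπu]
    exact hW g hg x hx
  have hinv : ∀ g ∈ SU2, ∀ x ∈ W', (u g).mulVec x ∈ W' := by
    intro g hg
    change W' ≤ W'.comap (Matrix.toLin' (u g))
    conv_lhs => rw [hW']
    rw [Submodule.span_le]
    rintro _ ⟨h, hh, x, hx, rfl⟩
    refine Submodule.subset_span ⟨g * h, mul_mem_SU2 hg hh, x, hx, ?_⟩
    rw [hu.mul g hg h hh, Matrix.toLin'_apply, Matrix.mulVec_mulVec]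
  refine (hu.irred W' hinv).imp (fun hbot => ?_) fun htop => ?_
  · rw [Submodule.eq_bot_iff]
    intro x hx
    have := hmem x hx
    rw [hbot, Submodule.mem_bot] at this
    rw [← hπι x, this, map_zero]
  · rw [Submodule.eq_top_iff']
    intro x
    rw [← hπι x]
    exact hle (htop ▸ Submodule.mem_top)

/-- The weight spaces of an irreducible representation have dimension at most one. -/
lemma IsIrrep.weights_injective (hu : IsIrrep u) (hw : HasWeights u lam) :
    Function.Injective lam := by
  intro a b hab
  set k := lam b
  set M : Matrix (Fin 2) (Fin 2) ℂ → Matrix {j // lam j = k} {j // lam j = k} ℂ :=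
    fun g => (u g).submatrix Subtype.val Subtype.val
  have hirr := hu.weight_block_irred (lam := lam) k
  have hscalar : ∀ g ∈ SU2, ∃ c : ℂ, M g = c • 1 := by
    intro g hg
    refine eq_smul_one_of_commute (S := M '' SU2) (fun W hW => hirr W fun h hh => ?_) ?_
    · exact hW _ ⟨h, hh, rfl⟩
    · rintro _ ⟨h, hh, rfl⟩
      ext i j
      have := hu.weight_block_commute hw k hh hg i.2 j.2
      rw [Finset.sum_subtype (p := fun j => lam j = k) _ (by simp),
        Finset.sum_subtype (p := fun j => lam j = k) _ (by simp)] at this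
      exact this
  set W : Submodule ℂ ({j // lam j = k} → ℂ) := Submodule.span ℂ {Pi.single ⟨b, rfl⟩ 1} with hW
  have hWtop : W = ⊤ := by
    refine (hirr W fun g hg x hx => ?_).resolve_left ?_
    · obtain ⟨c, hc⟩ := hscalar g hg
      change (M g).mulVec x ∈ W
      rw [hc, Matrix.smul_mulVec, Matrix.one_mulVec]
      exact W.smul_mem c hx
    · rw [hW, Submodule.span_singleton_eq_bot]
      simp
  have ha : Pi.single ⟨a, hab⟩ 1 ∈ W := hWtop ▸ Submodule.mem_top
  obtain ⟨c, hc⟩ := Submodule.mem_span_singleton.1 ha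
  by_contra hne
  have := congrFun hc ⟨a, hab⟩
  simp [hne] at this

lemma IsIrrep.rot_pi_div_two_apply (hu : IsIrrep u) (hw : HasWeights u lam) {a b : n}
    (hab : u (rot (Real.pi / 2)) a b ≠ 0) : lam b = -lam a := by
  refine int_eq_of_exp_eq fun θ => ?_
  have h := congrArg u (rot_pi_div_two_mul_torus θ)
  rw [hu.mul _ (rot_mem _) _ (torus_mem _), hu.mul _ (torus_mem _) _ (rot_mem _), hw, hw] at h
  have h' := congrFun (congrFun h a) b
  rw [Matrix.mul_diagonal, Matrix.diagonal_mul, mul_comm] at h'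
  rw [mul_right_cancel₀ hab h']
  congr 1
  push_cast
  ring

lemma IsIrrep.exists_weight_neg (hu : IsIrrep u) (hw : HasWeights u lam) (a : n) :
    ∃ b, lam b = -lam a := by
  by_contra! hne
  have hzero : ∀ b, u (rot (Real.pi / 2)) a b = 0 := fun b => by
    by_contra hab
    exact hne b (hu.rot_pi_div_two_apply hw hab)
  have h1 : u (rot (Real.pi / 2)) * u (rot (-(Real.pi / 2))) = 1 := by
    rw [← hu.mul _ (rot_mem _) _ (rot_mem _), ← rot_add, add_neg_cancel, rot_zero, hu.one]
  have h2 := congrFun (congrFun h1 a) a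
  simp [Matrix.mul_apply, hzero] at h2

lemma IsIrrep.weight_ne_zero (hu : IsIrrep u) (hw : HasWeights u lam)
    (hn : Even (Fintype.card n)) (a : n) : lam a ≠ 0 := by
  intro ha
  have hinj := hu.weights_injective hw
  choose σ hσ using hu.exists_weight_neg hw
  have hinv : Function.Involutive σ := fun b => hinj (by rw [hσ, hσ, neg_neg])
  have hsupp : hinv.toPerm.support = Finset.univ.erase a := by
    ext b
    rw [Equiv.Perm.mem_support, Finset.mem_erase, Function.Involutive.coe_toPerm]
    refine ⟨fun h => ⟨fun hb => h ?_, Finset.mem_univ _⟩, fun h hb => h.1 ?_⟩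
    · subst hb
      exact hinj (by rw [hσ, ha, neg_zero])
    · have := hσ b
      rw [hb] at this
      exact hinj (by omega)
  have hcard := Equiv.Perm.two_dvd_card_support (σ := hinv.toPerm)
    (Equiv.ext fun b => by simp [pow_two, hinv b])
  rw [hsupp, Finset.card_erase_of_mem (Finset.mem_univ a), Finset.card_univ] at hcard
  have : 0 < Fintype.card n := Fintype.card_pos_iff.2 ⟨a⟩
  obtain ⟨m, hm⟩ := hn
  omega

end Weights

lemma hasDerivAt_arcsin_sin_mul_cos (φ : ℝ) :
    HasDerivAt (fun θ : ℝ => Real.arcsin (Real.sin (2 * θ) * Real.cos (2 * φ)))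
      (2 * Real.cos (2 * φ)) 0 := by
  have h1 : HasDerivAt (fun θ : ℝ => Real.sin (2 * θ) * Real.cos (2 * φ))
      (Real.cos (2 * 0) * (2 * 1) * Real.cos (2 * φ)) 0 :=
    (((hasDerivAt_id (0 : ℝ)).const_mul 2).sin).mul_const _
  have h2 := (Real.hasDerivAt_arcsin (x := Real.sin (2 * 0) * Real.cos (2 * φ))
    (by simp) (by simp)).comp (0 : ℝ) h1
  refine h2.congr_deriv ?_
  simp

lemma hasDerivAt_arg_rotProdEntry (φ : ℝ) :
    HasDerivAt (fun θ : ℝ => (rotProdEntry φ θ).arg / 2) 0 0 := by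
  have h0 : rotProdEntry φ 0 = 1 := by simp [rotProdEntry]
  have hc := (Real.hasDerivAt_cos 0).ofReal_comp
  have hs := (Real.hasDerivAt_sin 0).ofReal_comp
  have h1 : HasDerivAt (rotProdEntry φ) 0 0 := by
    refine ((hc.fun_pow 2).fun_sub ((hs.fun_pow 2).mul_const _)).congr_deriv ?_
    simp
  have h2 : HasDerivAt (fun θ => Complex.log (rotProdEntry φ θ)) (0 / rotProdEntry φ 0) 0 :=
    h1.clog_real (by rw [h0]; exact Complex.one_mem_slitPlane)
  have h3 := (Complex.imCLM.hasFDerivAt.comp_hasDerivAt (0 : ℝ) h2).div_const 2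
  simpa [Function.comp_def, Complex.log_im] using h3

section Generator

open scoped Matrix.Norms.Operator

lemma exists_eq_exp_smul_matrix {n : Type*} [Fintype n] [DecidableEq n]
    {T : ℝ → Matrix n n ℂ} (hT : Continuous T) (hT0 : T 0 = 1)
    (hadd : ∀ s t, T (s + t) = T s * T t) :
    ∃ A : Matrix n n ℂ, HasDerivAt T A 0 ∧ ∀ t, T t = NormedSpace.exp (t • A) := by
  obtain ⟨A, hA⟩ := exists_eq_exp_smul hT hT0 hadd
  refine ⟨A, ?_, hA⟩
  have h := hasDerivAt_exp_smul_const A (0 : ℝ)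
  rw [zero_smul, NormedSpace.exp_zero, one_mul] at h
  rwa [funext hA]

variable {n : Type*} [Fintype n] [DecidableEq n]
  {u : Matrix (Fin 2) (Fin 2) ℂ → Matrix n n ℂ} {lam : n → ℤ}

/-- The infinitesimal rotation shifts weights by `2`. -/
lemma IsIrrep.rot_deriv_apply (hu : IsIrrep u) (hw : HasWeights u lam) {X : Matrix n n ℂ}
    (hX : HasDerivAt (fun θ => u (rot θ)) X 0) {a b : n} (hab : X a b ≠ 0) :
    lam a - lam b = 2 ∨ lam a - lam b = -2 := by
  obtain ⟨A, hA, -⟩ := exists_eq_exp_smul_matrix (T := fun θ => u (torus θ))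
    (hu.cont.comp_continuous continuous_torus torus_mem) (by simp [torus_zero, hu.one])
    (fun s t => by rw [torus_add, hu.mul _ (torus_mem _) _ (torus_mem _)])
  have hrel : ∀ φ : ℝ, u (torus φ) * X * u (torus (-2 * φ)) * u (torus φ) +
      u (torus φ) * u (torus (-2 * φ)) * X * u (torus φ) = (2 * Real.cos (2 * φ)) • X := by
    intro φ
    have hL : HasDerivAt (fun θ => u (torus φ) * u (rot θ) * u (torus (-2 * φ)) * u (rot θ) *
        u (torus φ)) (u (torus φ) * X * u (torus (-2 * φ)) * u (torus φ) +
          u (torus φ) * u (torus (-2 * φ)) * X * u (torus φ)) 0 := by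
      refine ((((hX.const_mul (u (torus φ))).mul_const (u (torus (-2 * φ)))).fun_mul hX).mul_const
        (u (torus φ))).congr_deriv ?_
      simp [rot_zero, hu.one, add_mul]
    have hβ : HasDerivAt (fun θ => u (torus ((rotProdEntry φ θ).arg / 2))) ((0 : ℝ) • A) 0 := by
      have h : HasDerivAt (fun θ => u (torus θ)) A ((rotProdEntry φ 0).arg / 2) := by
        simpa [rotProdEntry] using hA
      exact h.scomp (0 : ℝ) (hasDerivAt_arg_rotProdEntry φ)
    have hθ : HasDerivAt (fun θ => u (rot (Real.arcsin (Real.sin (2 * θ) * Real.cos (2 * φ)))))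
        ((2 * Real.cos (2 * φ)) • X) 0 := by
      have h : HasDerivAt (fun θ => u (rot θ)) X
          (Real.arcsin (Real.sin (2 * 0) * Real.cos (2 * φ))) := by
        simpa using hX
      exact h.scomp (0 : ℝ) (hasDerivAt_arcsin_sin_mul_cos φ)
    have hR := (hβ.fun_mul hθ).fun_mul hβ
    have heq : ∀ θ, u (torus φ) * u (rot θ) * u (torus (-2 * φ)) * u (rot θ) * u (torus φ) =
        u (torus ((rotProdEntry φ θ).arg / 2)) *
          u (rot (Real.arcsin (Real.sin (2 * θ) * Real.cos (2 * φ)))) *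
          u (torus ((rotProdEntry φ θ).arg / 2)) := by
      intro θ
      have h1 := mul_mem_SU2 (torus_mem φ) (rot_mem θ)
      have h2 := mul_mem_SU2 h1 (torus_mem (-2 * φ))
      have h3 := mul_mem_SU2 h2 (rot_mem θ)
      rw [← hu.mul _ (torus_mem _) _ (rot_mem _), ← hu.mul _ h1 _ (torus_mem _),
        ← hu.mul _ h2 _ (rot_mem _), ← hu.mul _ h3 _ (torus_mem _), torus_rot_torus_rot_torus,
        hu.mul _ (mul_mem_SU2 (torus_mem _) (rot_mem _)) _ (torus_mem _),
        hu.mul _ (torus_mem _) _ (rot_mem _)]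
    rw [← funext heq] at hR
    rw [hL.unique hR]
    simp [rotProdEntry, torus_zero, rot_zero, hu.one]
  have hcos : ∀ φ : ℝ, Real.cos ((lam a - lam b : ℤ) * φ) = Real.cos (2 * φ) := by
    intro φ
    have h := congrFun (congrFun (hrel φ) a) b
    rw [mul_assoc (u (torus φ) * X), hw, hw, Matrix.diagonal_mul_diagonal,
      Matrix.diagonal_mul_diagonal, Matrix.add_apply, Matrix.mul_diagonal, Matrix.diagonal_mul,
      Matrix.mul_diagonal, Matrix.diagonal_mul, ← Complex.exp_add, ← Complex.exp_add,
      Matrix.smul_apply, Complex.real_smul] at h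
    have h' : (Complex.cos ((lam a - lam b : ℤ) * φ : ℝ)) = Real.cos (2 * φ) := by
      refine mul_left_cancel₀ hab ?_
      rw [Complex.cos]
      push_cast at h ⊢
      have e1 : ((lam a : ℂ) - lam b) * φ * Complex.I =
        lam a * φ * Complex.I + (lam b * (-2 * φ) * Complex.I + lam b * φ * Complex.I) := by ring
      have e2 : -(((lam a : ℂ) - lam b) * φ) * Complex.I =
        lam a * φ * Complex.I + lam a * (-2 * φ) * Complex.I + lam b * φ * Complex.I := by ring
      rw [e1, e2]
      simp only [Complex.exp_add] at h ⊢
      linear_combination h / 2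
    exact_mod_cast h'
  generalize lam a - lam b = m at hcos
  have hm : m ≠ 0 := by
    rintro rfl
    have := hcos (Real.pi / 2)
    rw [mul_div_cancel₀ _ two_ne_zero] at this
    norm_num at this
  have hm' : (m : ℝ) ≠ 0 := Int.cast_ne_zero.2 hm
  have hodd : ∃ k : ℤ, m * (2 * k + 1) = 2 := by
    have h := hcos (Real.pi / m)
    rw [mul_div_cancel₀ _ hm'] at h
    obtain ⟨k, hk | hk⟩ := Real.cos_eq_cos_iff.1 h
    · refine ⟨k, ?_⟩
      have : (m : ℝ) * (2 * k + 1) = 2 := by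
        field_simp at hk
        linear_combination -hk
      exact_mod_cast this
    · refine ⟨k - 1, ?_⟩
      have : (m : ℝ) * (2 * (k - 1) + 1) = 2 := by
        field_simp at hk
        linear_combination -hk
      exact_mod_cast this
  obtain ⟨k, hk⟩ := hodd
  have hle : |m| ≤ 2 := Int.le_of_dvd two_pos ((abs_dvd _ _).2 ⟨_, hk.symm⟩)
  obtain ⟨h1, h2⟩ := abs_le.1 hle
  interval_cases m <;> omega

/-- An irreducible representation without weight zero is odd. -/
lemma IsIrrep.exists_odd_weight [Nonempty n] (hu : IsIrrep u) (hw : HasWeights u lam)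
    (h0 : ∀ a, lam a ≠ 0) : ∃ a, Odd (lam a) := by
  by_contra! hodd
  obtain ⟨X, hX, hexp⟩ := exists_eq_exp_smul_matrix (T := fun θ => u (rot θ))
    (hu.cont.comp_continuous continuous_rot rot_mem) (by simp [rot_zero, hu.one])
    (fun s t => by rw [rot_add, hu.mul _ (rot_mem _) _ (rot_mem _)])
  set E : Matrix n n ℂ := Matrix.diagonal fun j => if 0 < lam j then 1 else 0 with hE
  have hXE : Commute X E := by
    ext a b
    rw [hE, Matrix.mul_diagonal, Matrix.diagonal_mul]
    by_cases hab : X a b = 0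
    · simp [hab]
    · have h1 := hu.rot_deriv_apply hw hX hab
      have h2 := h0 a
      have h3 := h0 b
      have h4 := Int.not_odd_iff_even.1 (hodd a)
      have h5 := Int.not_odd_iff_even.1 (hodd b)
      have : 0 < lam b ↔ 0 < lam a := by
        obtain ⟨p, hp⟩ := h4
        obtain ⟨q, hq⟩ := h5
        omega
      simp [this]
  have hrotE : ∀ θ, Commute (u (rot θ)) E := fun θ => by
    rw [hexp θ]
    exact (hXE.smul_left θ).exp_left
  have htorusE : ∀ θ, Commute (u (torus θ)) E := fun θ => by
    rw [hw θ]
    exact Matrix.commute_diagonal _ _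
  obtain ⟨c, hc⟩ := hu.eq_smul_one (A := E) fun g hg => by
    obtain ⟨α, θ, β, rfl⟩ := exists_euler hg
    rw [hu.mul _ (mul_mem_SU2 (torus_mem _) (rot_mem _)) _ (torus_mem _),
      hu.mul _ (torus_mem _) _ (rot_mem _)]
    exact ((htorusE α).mul_left (hrotE θ)).mul_left (htorusE β)
  have hdiag : ∀ a, (if 0 < lam a then (1 : ℂ) else 0) = c := fun a => by
    have := congrFun (congrFun hc a) a
    simpa [hE] using this
  obtain ⟨a⟩ := ‹Nonempty n›
  obtain ⟨b, hb⟩ := hu.exists_weight_neg hw a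
  have hab := (hdiag a).trans (hdiag b).symm
  have := h0 a
  rcases lt_or_gt_of_ne this with h | h
  · rw [if_neg (by omega), if_pos (by omega)] at hab
    exact zero_ne_one hab
  · rw [if_pos (by omega), if_neg (by omega)] at hab
    exact one_ne_zero hab

end Generator

section Form

variable {n : Type*} [Fintype n] [DecidableEq n]
  {u : Matrix (Fin 2) (Fin 2) ℂ → Matrix n n ℂ} {lam : n → ℤ}

lemma IsIrrep.neg_one_of_odd_weight (hu : IsIrrep u) (hw : HasWeights u lam) {a : n}
    (ha : Odd (lam a)) : u (-1) = -1 := by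
  have hmem : (-1 : Matrix (Fin 2) (Fin 2) ℂ) ∈ SU2 := torus_pi ▸ torus_mem _
  obtain ⟨c, hc⟩ := hu.eq_smul_one (A := u (-1)) fun g hg => by
    rw [← hu.mul _ hg _ hmem, ← hu.mul _ hmem _ hg, mul_neg_one, neg_one_mul]
  have h := congrFun (congrFun hc a) a
  rw [← torus_pi, hw, Matrix.diagonal_apply_eq, Matrix.smul_apply, Matrix.one_apply_eq,
    smul_eq_mul, mul_one, mul_assoc, Complex.exp_int_mul, Complex.exp_pi_mul_I,
    ha.neg_one_zpow] at h
  rw [hc, ← h, neg_smul, one_smul]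

/-- An irreducible representation of even dimension has no invariant symmetric bilinear form. -/
lemma IsIrrep.symm_form_eq_zero [Nonempty n] (hu : IsIrrep u) (hw : HasWeights u lam)
    (hn : Even (Fintype.card n)) {B : Matrix n n ℂ} (hB : Bᵀ = B)
    (hinv : ∀ g ∈ SU2, (u g)ᵀ * B * u g = B) : B = 0 := by
  obtain ⟨a₀, ha₀⟩ := hu.exists_odd_weight hw (hu.weight_ne_zero hw hn)
  set w := u (rot (Real.pi / 2)) with hwdef
  have hsq : w * w = -1 := by
    rw [hwdef, ← hu.mul _ (rot_mem _) _ (rot_mem _), rot_pi_div_two_sq,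
      hu.neg_one_of_odd_weight hw ha₀]
  have hanti : (B * w)ᵀ = -(B * w) := by
    have h := congrArg (· * w) (hinv _ (rot_mem (Real.pi / 2)))
    simp only [← hwdef] at h
    rw [mul_assoc _ w w, hsq, mul_neg_one] at h
    rw [Matrix.transpose_mul, hB, ← h, neg_neg]
  have hBweight : ∀ a b, B a b ≠ 0 → lam a = -lam b := by
    intro a b hab
    refine int_eq_of_exp_eq fun θ => ?_
    have h := congrFun (congrFun (hinv _ (torus_mem θ)) a) b
    rw [hw, Matrix.diagonal_transpose, Matrix.mul_diagonal, Matrix.diagonal_mul,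
      mul_right_comm] at h
    have h1 : Complex.exp (lam a * θ * Complex.I) * Complex.exp (lam b * θ * Complex.I) = 1 :=
      mul_right_cancel₀ hab (h.trans (one_mul _).symm)
    rw [eq_inv_of_mul_eq_one_left h1, ← Complex.exp_neg]
    congr 1
    push_cast
    ring
  have hzero : B * w = 0 := by
    ext a b
    rcases eq_or_ne a b with rfl | hab
    · have h := congrFun (congrFun hanti a) a
      rw [Matrix.transpose_apply, Matrix.neg_apply] at h
      exact self_eq_neg.1 h
    · rw [Matrix.mul_apply, Matrix.zero_apply]
      refine Finset.sum_eq_zero fun j _ => ?_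
      by_contra hne
      have h1 := hBweight a j (left_ne_zero_of_mul hne)
      have h2 := hu.rot_pi_div_two_apply hw (right_ne_zero_of_mul hne)
      exact hab (hu.weights_injective hw (h1.trans h2.symm))
  have := congrArg (· * w) hzero
  simpa only [mul_assoc, hsq, mul_neg_one, zero_mul, neg_eq_zero] using this

end Form

section Diagonalization

open scoped Matrix.Norms.Operator

lemma exists_unitary_diagonalization {n : Type*} [Fintype n] [DecidableEq n]
    {T : ℝ → Matrix n n ℂ} (hT : Continuous T) (hT0 : T 0 = 1)
    (hadd : ∀ s t, T (s + t) = T s * T t) (hunit : ∀ t, T t ∈ Matrix.unitaryGroup n ℂ) :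
    ∃ S ∈ Matrix.unitaryGroup n ℂ, ∃ μ : n → ℝ, ∀ t,
      star S * T t * S = Matrix.diagonal fun j => Complex.exp (μ j * t * Complex.I) := by
  obtain ⟨A, hA, hexp⟩ := exists_eq_exp_smul_matrix hT hT0 hadd
  have hstar : ∀ t, star (T t) = T (-t) := fun t =>
    left_inv_eq_right_inv (hunit t).1 (by rw [← hadd, add_neg_cancel, hT0])
  have hskew : star A = -A := by
    have : @ContinuousStar (Matrix n n ℂ) PseudoMetricSpace.toUniformSpace.toTopologicalSpace _ :=
      ⟨(continuous_id.matrix_conjTranspose : Continuous fun M : Matrix n n ℂ => Mᴴ)⟩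
    have h1 : HasDerivAt (fun t => star (T t)) (star A) 0 := hA.star
    have h2 : HasDerivAt (fun t => T (-t)) (-A) 0 := by
      have h : HasDerivAt T A (-0) := by rwa [neg_zero]
      exact (h.scomp (0 : ℝ) (hasDerivAt_neg (0 : ℝ))).congr_deriv (by simp)
    rw [funext hstar] at h1
    exact h1.unique h2
  have hH : (-Complex.I • A).IsHermitian := by
    change star _ = _
    rw [star_smul, hskew]
    simp
  set S : Matrix n n ℂ := (hH.eigenvectorUnitary).1 with hS
  have hSu : S ∈ Matrix.unitaryGroup n ℂ := hH.eigenvectorUnitary.2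
  have hdiag : star S * A * S =
      Matrix.diagonal fun j => Complex.I * (hH.eigenvalues j : ℂ) := by
    have h := hH.conjStarAlgAut_star_eigenvectorUnitary
    rw [Unitary.conjStarAlgAut_star_apply] at h
    have h' := congrArg (Complex.I • ·) h
    simp only [← hS, mul_smul_comm, smul_mul_assoc, smul_smul] at h'
    simpa [← Matrix.diagonal_smul, Function.comp_def, Pi.smul_def] using h'
  have hinv : S⁻¹ = star S := Matrix.inv_eq_left_inv hSu.1
  refine ⟨S, hSu, hH.eigenvalues, fun t => ?_⟩
  rw [hexp, ← hinv, ← Matrix.exp_conj' _ _ (IsUnit.of_mul_eq_one _ hSu.2), hinv,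
    mul_smul_comm, smul_mul_assoc, hdiag, ← Matrix.diagonal_smul, Matrix.exp_diagonal]
  congr 1
  ext j
  rw [Pi.coe_exp, ← Complex.exp_eq_exp_ℂ, Pi.smul_apply, Complex.real_smul]
  congr 1
  ring

end Diagonalization

lemma IsIrrep.conj {n : Type*} [Fintype n] [DecidableEq n]
    {u : Matrix (Fin 2) (Fin 2) ℂ → Matrix n n ℂ} (hu : IsIrrep u) {S : Matrix n n ℂ}
    (hS : S ∈ Matrix.unitaryGroup n ℂ) : IsIrrep fun g => star S * u g * S where
  cont := (continuousOn_const.mul hu.cont).mul continuousOn_const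
  one := by rw [hu.one, mul_one]; exact hS.1
  mul g hg h hh := by
    have hS' : S * star S = 1 := hS.2
    rw [hu.mul g hg h hh]
    calc star S * (u g * u h) * S = star S * u g * (1 * u h) * S := by
          rw [one_mul]; simp only [mul_assoc]
      _ = star S * u g * S * (star S * u h * S) := by rw [← hS']; simp only [mul_assoc]
  irred W hW := by
    have hS1 : star S * S = 1 := hS.1
    have hS2 : S * star S = 1 := hS.2
    have hcomap : W = (W.comap (Matrix.toLin' (star S))).comap (Matrix.toLin' S) := by
      ext x
      simp [hS1]
    have h := hu.irred (W.comap (Matrix.toLin' (star S))) fun g hg x hx => by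
      have := hW g hg _ hx
      simp only [Submodule.mem_comap, Matrix.toLin'_apply, Matrix.mulVec_mulVec] at this ⊢
      rwa [mul_assoc _ S, hS2, mul_one] at this
    refine h.imp (fun h => ?_) fun h => ?_
    · rw [hcomap, h, Submodule.eq_bot_iff]
      intro x hx
      rw [Submodule.mem_comap, Submodule.mem_bot, Matrix.toLin'_apply] at hx
      rw [← Matrix.one_mulVec x, ← hS1, ← Matrix.mulVec_mulVec, hx, Matrix.mulVec_zero]
    · rw [hcomap, h, Submodule.comap_top]

lemma IsIrrep.exists_hasWeights {n : Type*} [Fintype n] [DecidableEq n]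
    {u : Matrix (Fin 2) (Fin 2) ℂ → Matrix n n ℂ} (hu : IsIrrep u)
    (hunit : ∀ g ∈ SU2, u g ∈ Matrix.unitaryGroup n ℂ) :
    ∃ S ∈ Matrix.unitaryGroup n ℂ, ∃ lam : n → ℤ,
      HasWeights (fun g => star S * u g * S) lam := by
  obtain ⟨S, hS, μ, hμ⟩ := exists_unitary_diagonalization (T := fun θ => u (torus θ))
    (hu.cont.comp_continuous continuous_torus torus_mem) (by simp [torus_zero, hu.one])
    (fun s t => by rw [torus_add, hu.mul _ (torus_mem _) _ (torus_mem _)])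
    fun t => hunit _ (torus_mem t)
  have hinteger : ∀ j, ∃ k : ℤ, μ j = k := by
    intro j
    have h := congrFun (congrFun (hμ (2 * Real.pi)) j) j
    have hS1 : star S * S = 1 := hS.1
    rw [torus_two_pi, hu.one, mul_one, hS1, Matrix.one_apply_eq, Matrix.diagonal_apply_eq] at h
    obtain ⟨k, hk⟩ := Complex.exp_eq_one_iff.1 h.symm
    refine ⟨k, ?_⟩
    have h2 : (μ j : ℂ) = k := by
      refine mul_right_cancel₀ Complex.two_pi_I_ne_zero ?_
      rw [← hk]
      push_cast
      ring
    exact_mod_cast h2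
  choose lam hlam using hinteger
  refine ⟨S, hS, lam, fun θ => ?_⟩
  refine (hμ θ).trans ?_
  simp only [hlam, Complex.ofReal_intCast]

/-- If `r₀` is a unitary with `r₀² = I` intertwining a continuous irreducible
unitary representation `u` of `SU(2)` on `ℂ^d` with its entrywise conjugate,
and `d` is even, then `conj r₀ = -r₀`, i.e. `r₀` has purely imaginary entries. -/
theorem stmt_6 (d : ℕ) (hd_pos : 0 < d) (hd_even : Even d)
    (u : Matrix (Fin 2) (Fin 2) ℂ → Matrix (Fin d) (Fin d) ℂ)
    (hu_cont : ContinuousOn u SU2)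
    (hu_one : u 1 = 1)
    (hu_mul : ∀ g ∈ SU2, ∀ h ∈ SU2, u (g * h) = u g * u h)
    (hu_unitary : ∀ g ∈ SU2, u g ∈ Matrix.unitaryGroup (Fin d) ℂ)
    (hu_irred : ∀ W : Submodule ℂ (Fin d → ℂ),
      (∀ g ∈ SU2, ∀ x ∈ W, (u g).mulVec x ∈ W) → W = ⊥ ∨ W = ⊤)
    (r₀ : Matrix (Fin d) (Fin d) ℂ)
    (hr₀_unitary : r₀ ∈ Matrix.unitaryGroup (Fin d) ℂ)
    (hr₀_sq : r₀ * r₀ = 1)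
    (hr₀ : ∀ g ∈ SU2, r₀ * u g * star r₀ = (u g).map (starRingEnd ℂ)) :
    r₀.map (starRingEnd ℂ) = -r₀ := by
  have : Nonempty (Fin d) := ⟨⟨0, hd_pos⟩⟩
  have hu : IsIrrep u := ⟨hu_cont, hu_one, hu_mul, hu_irred⟩
  have hstar : star r₀ = r₀ := left_inv_eq_right_inv hr₀_unitary.1 hr₀_sq
  have hconj : r₀.map (starRingEnd ℂ) = r₀ᵀ := by
    conv_rhs => rw [← hstar]
    rfl
  have hinter : ∀ g ∈ SU2, r₀ * u g = (u g).map (starRingEnd ℂ) * r₀ := fun g hg => by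
    rw [← hr₀ g hg, hstar, mul_assoc, hr₀_sq, mul_one]
  have hinter' : ∀ g ∈ SU2, r₀ᵀ * (u g).map (starRingEnd ℂ) = u g * r₀ᵀ := fun g hg => by
    have h := congrArg (fun M => M.map (starRingEnd ℂ)) (hinter g hg)
    simp only [Matrix.map_mul, hconj] at h
    rw [h]
    congr 1
    ext i j
    simp
  obtain ⟨c, hc⟩ := hu.eq_smul_one (A := r₀ᵀ * r₀) fun g hg => by
    rw [← mul_assoc, ← hinter' g hg, mul_assoc, ← hinter g hg, mul_assoc]
  have hct : r₀ᵀ = c • r₀ := by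
    rw [← one_mul r₀, ← smul_mul_assoc, ← hc, one_mul, mul_assoc, hr₀_sq, mul_one]
  have hne : r₀ ≠ 0 := by
    rintro rfl
    rw [mul_zero] at hr₀_sq
    exact zero_ne_one hr₀_sq
  have hcc : c * c = 1 := by
    have h := congrArg Matrix.transpose hct
    rw [Matrix.transpose_transpose, Matrix.transpose_smul, hct, smul_smul] at h
    exact smul_left_injective ℂ hne (h.symm.trans (one_smul ℂ r₀).symm)
  rw [hconj, hct]
  rcases mul_self_eq_one_iff.1 hcc with rfl | rfl
  · rw [one_smul] at hct
    have hform : ∀ g ∈ SU2, (u g)ᵀ * r₀ * u g = r₀ := fun g hg => by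
      have h1 : (u g)ᵀ * (u g).map (starRingEnd ℂ) = 1 := by
        have h := congrArg Matrix.transpose (hu_unitary g hg).1
        rwa [Matrix.transpose_mul, Matrix.transpose_one] at h
      rw [mul_assoc, hinter g hg, ← mul_assoc, h1, one_mul]
    obtain ⟨S, hS, lam, hw⟩ := hu.exists_hasWeights hu_unitary
    have hS1 : star S * S = 1 := hS.1
    have hS2 : S * star S = 1 := hS.2
    have hS2t : (star S)ᵀ * Sᵀ = 1 := by
      rw [← Matrix.transpose_mul, hS2, Matrix.transpose_one]
    have hB := (hu.conj hS).symm_form_eq_zero hw (by simpa using hd_even)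
      (B := Sᵀ * r₀ * S) (by
        rw [Matrix.transpose_mul, Matrix.transpose_mul, Matrix.transpose_transpose, hct,
          mul_assoc]) fun g hg => by
        calc (star S * u g * S)ᵀ * (Sᵀ * r₀ * S) * (star S * u g * S)
            = Sᵀ * ((u g)ᵀ * (((star S)ᵀ * Sᵀ) * r₀ * (S * star S)) * u g) * S := by
              simp only [Matrix.transpose_mul, mul_assoc]
          _ = Sᵀ * r₀ * S := by rw [hS2t, hS2, one_mul, mul_one, hform g hg]
    refine absurd ?_ hne
    calc r₀ = ((star S)ᵀ * Sᵀ) * r₀ * (S * star S) := by rw [hS2t, hS2, one_mul, mul_one]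
      _ = (star S)ᵀ * (Sᵀ * r₀ * S) * star S := by simp only [mul_assoc]
      _ = 0 := by rw [hB, mul_zero, zero_mul]
  · rw [neg_smul, one_smul]
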